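/- Let 0 < a < 2^{-1/6}, let ℓ > 0, let N ≥ 2, and let (x*_1,…,x*_N) be a minimum-energy configuration for the cut-off Lennard-Jones potential V_a such that x*_1 = 0 and W⁺_a(1, x*) = max_{1≤i≤N} W⁺_a(i, x*). Then there exists z ∈ ℤ³ such that the half-open grid cube ℓz + [0,ℓ)³ contains at least (23/32) · W⁺_a(x*) / (⌈4/ℓ⌉ + 1)³ of the points x*_1,…,x*_N. -/

import Mathlib

open MeasureTheory Real

noncomputable section

abbrev E3 := EuclideanSpace ℝ (Fin 3)

/-- Lennard-Jones potential -/
def VLJ (r : ℝ) : ℝ := 1 / r ^ 12 - 2 / r ^ 6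

/-- cut-off Lennard-Jones potential -/
def Va (a r : ℝ) : ℝ := if a < r then VLJ r else VLJ a

/-- configurational energy of N particles -/
def pairEnergy (V : ℝ → ℝ) {N : ℕ} (x : Fin N → E3) : ℝ :=
  ∑ p ∈ Finset.univ.filter (fun p : Fin N × Fin N => p.1 < p.2), V ‖x p.1 - x p.2‖

/-- stability with constant B -/
def IsStableWith (V : ℝ → ℝ) (B : ℝ) : Prop :=
  0 ≤ B ∧ ∀ (N : ℕ) (x : Fin N → E3), -(B * N) ≤ pairEnergy V x

/-- stability constant: infimum of admissible stability constants -/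
def stabConst (V : ℝ → ℝ) : ℝ := sInf {B | IsStableWith V B}

def IsMinEnergy (V : ℝ → ℝ) {N : ℕ} (x : Fin N → E3) : Prop :=
  ∀ y : Fin N → E3, pairEnergy V x ≤ pairEnergy V y

def IsTempered (V : ℝ → ℝ) : Prop :=
  ∃ r₀ : ℝ, 0 ≤ r₀ ∧ IntegrableOn (fun x : E3 => |V ‖x‖|) {x | r₀ ≤ ‖x‖}

open scoped Classical in
/-- n-th Mayer coefficient -/
def mayerCoeff (V : ℝ → ℝ) (β : ℝ) (Λ : Set E3) (n : ℕ) : ℝ :=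
  (volume Λ).toReal⁻¹ * (n.factorial : ℝ)⁻¹ *
    ∫ x : Fin n → E3 in Set.univ.pi fun _ => Λ,
      ∑ g ∈ Finset.univ.filter (fun g : SimpleGraph (Fin n) => g.Connected),
        ∏ e ∈ Finset.univ.filter (fun e : Sym2 (Fin n) => e ∈ g.edgeSet),
          Sym2.lift ⟨fun i j => Real.exp (-β * V ‖x i - x j‖) - 1,
            fun i j => by simp only [norm_sub_rev (x i)]⟩ e

/-- positive part of the interaction of particle `i` with the others:
sum over the particles at distance `< 2^{-1/6}` from particle `i` -/
def Wplus (a : ℝ) {N : ℕ} (x : Fin N → E3) (i : Fin N) : ℝ :=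
  ∑ j ∈ Finset.univ.filter
      (fun j : Fin N => j ≠ i ∧ ‖x i - x j‖ < (2 : ℝ) ^ (-(1 : ℝ) / 6)),
    Va a ‖x i - x j‖

/-- maximal positive interaction `W⁺_a(x) = max_i W⁺_a(i,x)` -/
def WplusMax (a : ℝ) {N : ℕ} (x : Fin N → E3) : ℝ :=
  sSup {w : ℝ | ∃ i : Fin N, w = Wplus a x i}

/-- The pair energy splits off the interaction of the first particle. -/
lemma pairEnergy_succ (V : ℝ → ℝ) {n : ℕ} (x : Fin (n + 1) → E3) :
    pairEnergy V x = ∑ j : Fin n, V ‖x 0 - x j.succ‖ + pairEnergy V (fun i : Fin n => x i.succ) := by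
  unfold pairEnergy
  simp only [Finset.sum_filter, Fintype.sum_prod_type]
  rw [Fin.sum_univ_succ, Fin.sum_univ_succ]
  simp [Fin.sum_univ_succ]

lemma exists_far_point {n : ℕ} (x : Fin n → E3) : ∃ y : E3, ∀ j, 1 ≤ ‖y - x j‖ := by
  obtain ⟨y, hy⟩ := NormedSpace.exists_lt_norm ℝ E3 (1 + ∑ j, ‖x j‖)
  refine ⟨y, fun j => ?_⟩
  have h₁ := norm_sub_norm_le y (x j)
  have h₂ := Finset.single_le_sum (fun i _ => norm_nonneg (x i)) (Finset.mem_univ j)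
  linarith

lemma VLJ_nonpos_of_one_le {r : ℝ} (hr : 1 ≤ r) : VLJ r ≤ 0 := by
  unfold VLJ
  have h₁ : 1 / r ^ 12 ≤ 1 / r ^ 6 :=
    one_div_le_one_div_of_le (by positivity) (pow_le_pow_right₀ hr (by norm_num))
  have h₂ : 2 / r ^ 6 = 2 * (1 / r ^ 6) := by ring
  have h₃ : 0 ≤ 1 / r ^ 6 := by positivity
  linarith

lemma neg_one_le_VLJ (r : ℝ) : -1 ≤ VLJ r := by
  have h : VLJ r = (1 / r ^ 6 - 1) ^ 2 - 1 := by unfold VLJ; ring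
  rw [h]
  linarith [sq_nonneg (1 / r ^ 6 - 1)]

lemma neg_two_div_le_VLJ {r s : ℝ} (hs : 0 < s) (hr : s ≤ r) : -(2 / s ^ 6) ≤ VLJ r := by
  have hr₀ : 0 < r := hs.trans_le hr
  have h₁ : 2 / r ^ 6 ≤ 2 / s ^ 6 := by gcongr
  have h₂ : 0 ≤ 1 / r ^ 12 := by positivity
  unfold VLJ
  linarith

/-- In a minimum-energy configuration the total interaction of the first particle is nonpositive,
since that particle can be moved far away from the others. -/
lemma IsMinEnergy.sum_first_nonpos {a : ℝ} (ha : a < 1) {n : ℕ} {x : Fin (n + 1) → E3}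
    (hx : IsMinEnergy (Va a) x) : ∑ j : Fin n, Va a ‖x 0 - x j.succ‖ ≤ 0 := by
  obtain ⟨y, hy⟩ := exists_far_point fun i : Fin n => x i.succ
  have h := hx (Fin.cons y fun i : Fin n => x i.succ)
  rw [pairEnergy_succ, pairEnergy_succ] at h
  simp only [Fin.cons_zero, Fin.cons_succ] at h
  have h' : ∑ j : Fin n, Va a ‖y - x j.succ‖ ≤ 0 := Finset.sum_nonpos fun j _ => by
    rw [Va, if_pos (ha.trans_le (hy j))]
    exact VLJ_nonpos_of_one_le (hy j)
  linarith

/-- Weight of the dyadic shell `2 ^ k ≤ r < 2 ^ (k + 1)` in the bound on the attractive part. -/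
def shellWeight (k : ℕ) : ℝ := if k = 0 then 1 else 2 / 64 ^ k

lemma shellWeight_nonneg (k : ℕ) : 0 ≤ shellWeight k := by
  unfold shellWeight
  split_ifs <;> positivity

lemma sum_shellWeight_mul_pow_le (m : ℕ) :
    ∑ k ∈ Finset.range (m + 1), shellWeight k * 8 ^ k ≤ 9 / 7 := by
  have h : ∀ m : ℕ, ∑ k ∈ Finset.range (m + 1), shellWeight k * 8 ^ k
      = 9 / 7 - 2 / 7 * (1 / 8) ^ m := by
    intro m
    induction m with
    | zero => norm_num [shellWeight]
    | succ m ih =>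
      rw [Finset.sum_range_succ, ih, shellWeight, if_neg (Nat.succ_ne_zero m),
        show (64 : ℝ) = 8 * 8 by norm_num, mul_pow, one_div_pow, one_div_pow, pow_succ]
      field_simp
      ring
  rw [h]
  have : (0 : ℝ) ≤ 2 / 7 * (1 / 8) ^ m := by positivity
  linarith

lemma neg_sum_shellWeight_le_VLJ {r : ℝ} {m : ℕ} (hr : r < 2 * 2 ^ m) :
    -∑ k ∈ Finset.range (m + 1), shellWeight k * (if r < 2 * 2 ^ k then 1 else 0) ≤ VLJ r := by
  have hex : ∃ k, r < 2 * 2 ^ k := ⟨m, hr⟩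
  classical
  have hk := Nat.find_spec hex
  have hmin := fun j => Nat.find_min hex (m := j)
  have hkm : Nat.find hex ≤ m := Nat.find_min' hex hr
  generalize Nat.find hex = k at hk hmin hkm
  have h₁ : shellWeight k ≤
      ∑ k ∈ Finset.range (m + 1), shellWeight k * (if r < 2 * 2 ^ k then 1 else 0) := by
    have := Finset.single_le_sum
      (f := fun k => shellWeight k * (if r < 2 * 2 ^ k then (1 : ℝ) else 0))
      (fun i _ => mul_nonneg (shellWeight_nonneg i) (by split_ifs <;> norm_num))
      (Finset.mem_range.2 (Nat.lt_succ_of_le hkm))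
    simpa [hk] using this
  refine (neg_le_neg h₁).trans ?_
  rcases k with _ | k
  · simpa [shellWeight] using neg_one_le_VLJ r
  · have hs : (2 : ℝ) ^ (k + 1) ≤ r := by
      rw [pow_succ']
      exact not_lt.1 (hmin k (Nat.lt_succ_self k))
    have := neg_two_div_le_VLJ (by positivity) hs
    rw [shellWeight, if_neg (Nat.succ_ne_zero k)]
    rwa [← pow_mul, mul_comm, pow_mul, show (2 : ℝ) ^ 6 = 64 by norm_num] at this

lemma floor_add_ceil_le (b : ℝ) : ⌊b⌋ + ⌈b⌉ ≤ ⌈2 * b⌉ := by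
  have h₁ := Int.floor_le b
  have h₂ := Int.ceil_lt_add_one b
  have h₃ := Int.le_ceil (2 * b)
  have : ((⌊b⌋ + ⌈b⌉ : ℤ) : ℝ) < ((⌈2 * b⌉ + 1 : ℤ) : ℝ) := by
    push_cast
    linarith
  exact Int.lt_add_one_iff.1 (by exact_mod_cast this)

/-- Per axis, an interval `(-2n, 2n)` meets at most `n (⌈4/ℓ⌉ + 1)` grid intervals of length `ℓ`. -/
lemma card_Icc_floor_le {ℓ : ℝ} (hℓ : 0 < ℓ) {n : ℕ} (hn : 1 ≤ n) :
    ((Finset.Icc ⌊-(2 * n / ℓ)⌋ ⌊2 * n / ℓ⌋).card : ℝ) ≤ n * ((⌈4 / ℓ⌉ : ℝ) + 1) := by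
  have hceil : 0 ≤ ⌈4 / ℓ⌉ := Int.ceil_nonneg (by positivity)
  have h₁ := floor_add_ceil_le (2 * n / ℓ)
  have h₂ : ⌈2 * (2 * n / ℓ)⌉ ≤ n * ⌈4 / ℓ⌉ := by
    rw [Int.ceil_le]
    push_cast
    calc 2 * (2 * n / ℓ) = n * (4 / ℓ) := by ring
      _ ≤ n * (⌈4 / ℓ⌉ : ℝ) := by gcongr; exact Int.le_ceil _
  have hn' : (1 : ℤ) ≤ n := by exact_mod_cast hn
  have h₃ : ((Finset.Icc ⌊-(2 * n / ℓ)⌋ ⌊2 * n / ℓ⌋).card : ℤ) ≤ n * (⌈4 / ℓ⌉ + 1) := by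
    rw [Int.card_Icc, Int.floor_neg]
    have h₄ : n * ⌈4 / ℓ⌉ + 1 ≤ n * (⌈4 / ℓ⌉ + 1) := by linarith
    have h₅ : 0 ≤ n * (⌈4 / ℓ⌉ + 1) := by positivity
    omega
  exact_mod_cast h₃

/-- If every grid cube holds at most `L` points, then the ball of radius `2n` holds at most
`(n (⌈4/ℓ⌉ + 1))³ L` points. -/
lemma card_ball_le {ℓ : ℝ} (hℓ : 0 < ℓ) {N : ℕ} (x : Fin N → E3) {L : ℝ}
    (hL : ∀ z : Fin 3 → ℤ, ((Finset.univ.filter (fun i : Fin N =>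
          ∀ k : Fin 3, ℓ * (z k : ℝ) ≤ x i k ∧ x i k < ℓ * (z k : ℝ) + ℓ)).card : ℝ) ≤ L)
    {n : ℕ} (hn : 1 ≤ n) :
    ((Finset.univ.filter fun i : Fin N => ‖x i‖ < 2 * n).card : ℝ)
      ≤ (n * ((⌈4 / ℓ⌉ : ℝ) + 1)) ^ 3 * L := by
  classical
  have hL₀ : 0 ≤ L := (Nat.cast_nonneg _).trans (hL 0)
  set T : Finset (Fin 3 → ℤ) :=
    Fintype.piFinset fun _ => Finset.Icc ⌊-(2 * n / ℓ)⌋ ⌊2 * n / ℓ⌋ with hT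
  let cell : Fin N → Fin 3 → ℤ := fun i k => ⌊x i k / ℓ⌋
  have hmaps : ∀ i ∈ Finset.univ.filter (fun i : Fin N => ‖x i‖ < 2 * n), cell i ∈ T := by
    intro i hi
    have hi : ‖x i‖ < 2 * n := (Finset.mem_filter.1 hi).2
    refine Fintype.mem_piFinset.2 fun k => Finset.mem_Icc.2 ?_
    have hk : |x i k| ≤ 2 * n := (PiLp.norm_apply_le (x i) k).trans hi.le
    obtain ⟨h₁, h₂⟩ := abs_le.1 hk
    refine ⟨Int.floor_le_floor ?_, Int.floor_le_floor ?_⟩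
    · rw [← neg_div]
      gcongr
    · gcongr
  have hfiber : ∀ z ∈ T, (((Finset.univ.filter fun i : Fin N => ‖x i‖ < 2 * n).filter
      fun i => cell i = z).card : ℝ) ≤ L := by
    intro z _
    refine le_trans (Nat.cast_le.2 (Finset.card_le_card fun i hi => ?_)) (hL z)
    have hz : cell i = z := (Finset.mem_filter.1 hi).2
    refine Finset.mem_filter.2 ⟨Finset.mem_univ i, fun k => ?_⟩
    obtain ⟨h₁, h₂⟩ := Int.floor_eq_iff.1 (congrFun hz k)
    rw [le_div_iff₀ hℓ] at h₁
    rw [div_lt_iff₀ hℓ] at h₂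
    constructor <;> linarith
  rw [Finset.card_eq_sum_card_fiberwise hmaps]
  push_cast
  refine (Finset.sum_le_card_nsmul T _ L hfiber).trans ?_
  rw [nsmul_eq_mul, hT, Fintype.card_piFinset_const]
  push_cast
  gcongr
  exact card_Icc_floor_le hℓ hn

/-- The repulsive part of the first particle is dominated by the dyadic counts around it. -/
lemma Wplus_zero_le {a : ℝ} (ha' : a < (2 : ℝ) ^ (-(1 : ℝ) / 6)) {n : ℕ} {x : Fin (n + 1) → E3}
    (hx : IsMinEnergy (Va a) x) (h0 : x 0 = 0) {m : ℕ} (hm : ∀ i, ‖x i‖ < 2 * 2 ^ m) :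
    Wplus a x 0 ≤ ∑ k ∈ Finset.range (m + 1), shellWeight k *
      ((Finset.univ.filter fun i : Fin (n + 1) => ‖x i‖ < 2 * 2 ^ k).card : ℝ) := by
  have ha₁ : a < 1 := ha'.trans (Real.rpow_lt_one_of_one_lt_of_neg (by norm_num) (by norm_num))
  set ρ : ℝ := (2 : ℝ) ^ (-(1 : ℝ) / 6) with hρ
  set S : Fin (n + 1) → ℝ := fun i =>
    ∑ k ∈ Finset.range (m + 1), shellWeight k * (if ‖x i‖ < 2 * 2 ^ k then 1 else 0) with hS
  have hS₀ : ∀ i, 0 ≤ S i := fun i => Finset.sum_nonneg fun k _ =>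
    mul_nonneg (shellWeight_nonneg k) (by split_ifs <;> norm_num)
  have hW : Wplus a x 0 = ∑ j : Fin n, if ‖x j.succ‖ < ρ then Va a ‖x j.succ‖ else 0 := by
    rw [Wplus, Finset.sum_filter, Fin.sum_univ_succ]
    simp [h0, hρ]
  have hterm : ∀ j : Fin n, (if ‖x j.succ‖ < ρ then Va a ‖x j.succ‖ else 0)
      ≤ Va a ‖x 0 - x j.succ‖ + S j.succ := by
    intro j
    rw [h0, zero_sub, norm_neg]
    split_ifs with h
    · linarith [hS₀ j.succ]
    · rw [Va, if_pos (ha'.trans_le (not_lt.1 h))]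
      linarith [neg_sum_shellWeight_le_VLJ (hm j.succ)]
  calc Wplus a x 0 ≤ ∑ j : Fin n, (Va a ‖x 0 - x j.succ‖ + S j.succ) := by
        rw [hW]
        exact Finset.sum_le_sum fun j _ => hterm j
    _ ≤ ∑ j : Fin n, S j.succ := by
        rw [Finset.sum_add_distrib]
        linarith [hx.sum_first_nonpos ha₁]
    _ ≤ ∑ i, S i := by
        rw [Fin.sum_univ_succ]
        linarith [hS₀ 0]
    _ = _ := by
        rw [hS, Finset.sum_comm]
        simp only [← Finset.mul_sum, Finset.sum_boole]

/-- in a minimum-energy configuration with the first particle at the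
origin realizing the maximal positive interaction, some half-open grid cube of
side `ℓ` contains at least `(23/32)·W⁺_a(x*)/(⌈4/ℓ⌉+1)³` particles. -/
theorem stmt12 (a : ℝ) (ha : 0 < a) (ha' : a < (2 : ℝ) ^ (-(1 : ℝ) / 6))
    (ℓ : ℝ) (hℓ : 0 < ℓ)
    (N : ℕ) (hN : 1 ≤ N) (x : Fin N → E3) (hx : IsMinEnergy (Va a) x)
    (h0 : x ⟨0, by omega⟩ = 0)
    (hmax : Wplus a x ⟨0, by omega⟩ = WplusMax a x) :
    ∃ z : Fin 3 → ℤ,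
      (23 / 32 : ℝ) * WplusMax a x / ((⌈(4 : ℝ) / ℓ⌉ : ℝ) + 1) ^ 3 ≤
        (Finset.univ.filter (fun i : Fin N =>
          ∀ k : Fin 3, ℓ * (z k : ℝ) ≤ x i k ∧ x i k < ℓ * (z k : ℝ) + ℓ)).card := by
  obtain ⟨n, rfl⟩ : ∃ n, N = n + 1 := ⟨N - 1, by omega⟩
  rw [← hmax]
  change x 0 = 0 at h0
  change ∃ z : Fin 3 → ℤ, (23 / 32 : ℝ) * Wplus a x 0 / ((⌈(4 : ℝ) / ℓ⌉ : ℝ) + 1) ^ 3 ≤ _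
  by_contra! hcon
  have hK : 0 < (⌈4 / ℓ⌉ : ℝ) + 1 := by
    have : (0 : ℝ) ≤ ⌈4 / ℓ⌉ := by exact_mod_cast Int.ceil_nonneg (by positivity)
    linarith
  set K : ℝ := (⌈4 / ℓ⌉ : ℝ) + 1 with hKdef
  set L : ℝ := 23 / 32 * Wplus a x 0 / K ^ 3 with hLdef
  have hL : 0 < L := (Nat.cast_nonneg _).trans_lt (hcon 0)
  have hKL : K ^ 3 * L = 23 / 32 * Wplus a x 0 := by
    rw [hLdef]
    field_simp
  obtain ⟨m, hm⟩ := pow_unbounded_of_one_lt (∑ i, ‖x i‖) (one_lt_two : (1 : ℝ) < 2)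
  have hfar : ∀ i, ‖x i‖ < 2 * 2 ^ m := fun i => by
    have h₁ := Finset.single_le_sum (fun i _ => norm_nonneg (x i)) (Finset.mem_univ i)
    have h₂ : (0 : ℝ) < 2 ^ m := by positivity
    linarith
  have hcount : ∀ k : ℕ, ((Finset.univ.filter fun i => ‖x i‖ < 2 * 2 ^ k).card : ℝ)
      ≤ 8 ^ k * (K ^ 3 * L) := fun k => by
    have h := card_ball_le hℓ x (fun z => (hcon z).le) (n := 2 ^ k) Nat.one_le_two_pow
    push_cast at h
    refine h.trans_eq ?_
    rw [← hKdef, show (8 : ℝ) = 2 ^ 3 by norm_num, ← pow_mul, mul_comm 3 k, pow_mul]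
    ring
  have hsum : Wplus a x 0 ≤ 9 / 7 * (K ^ 3 * L) := calc
    Wplus a x 0 ≤ ∑ k ∈ Finset.range (m + 1), shellWeight k *
        ((Finset.univ.filter fun i => ‖x i‖ < 2 * 2 ^ k).card : ℝ) := Wplus_zero_le ha' hx h0 hfar
    _ ≤ ∑ k ∈ Finset.range (m + 1), shellWeight k * (8 ^ k * (K ^ 3 * L)) :=
        Finset.sum_le_sum fun k _ => mul_le_mul_of_nonneg_left (hcount k) (shellWeight_nonneg k)
    _ = (∑ k ∈ Finset.range (m + 1), shellWeight k * 8 ^ k) * (K ^ 3 * L) := by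
        rw [Finset.sum_mul]
        exact Finset.sum_congr rfl fun k _ => by ring
    _ ≤ 9 / 7 * (K ^ 3 * L) :=
        mul_le_mul_of_nonneg_right (sum_shellWeight_mul_pow_le m) (by positivity)
  have hpos : 0 < K ^ 3 * L := by positivity
  linarith

end
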